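/- arXiv:1807.05961 — 2 statements merged into one kernel-verified Lean document; each statement's English description precedes it below -/
import Mathlib

section
/- For every n ≥ 1 and t > 0, the quantities σ_n satisfy the non-linear second order difference equation 4(−1)^n n t (σ_{n+1}(t) − σ_{n−1}(t)) [4(−1)^n t + (σ_{n−1}(t) − σ_n(t))(σ_n(t) − σ_{n+1}(t))] + n² (σ_{n−1}(t) − σ_n(t))² (σ_n(t) − σ_{n+1}(t))² = [σ_n(t) − 2(1 − (−1)^n) t] · [4(−1)^n t + (σ_{n−1}(t) − σ_n(t))(σ_n(t) − σ_{n+1}(t))]². -/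
open MeasureTheory Polynomial

/-- The singularly perturbed Gaussian weight `w(x,t) = exp(-x^2 - t/x^2)` for `x ≠ 0`,
extended by `0` at `x = 0`. -/
noncomputable def w (t x : ℝ) : ℝ := if x = 0 then 0 else Real.exp (-x ^ 2 - t / x ^ 2)

section Analysis

variable {t : ℝ}

theorem w_nonneg (t x : ℝ) : 0 ≤ w t x := by
  unfold w; split_ifs <;> positivity

theorem w_neg (t x : ℝ) : w t (-x) = w t x := by
  simp [w]

theorem w_le (ht : 0 < t) (x : ℝ) : w t x ≤ x ^ 2 / t * Real.exp (-x ^ 2) := by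
  unfold w
  split_ifs with hx
  · subst hx; simp
  · rw [sub_eq_add_neg, Real.exp_add, mul_comm]
    refine mul_le_mul_of_nonneg_right ?_ (Real.exp_pos _).le
    rw [Real.exp_neg]
    have hpos : 0 < t / x ^ 2 := by positivity
    calc (Real.exp (t / x ^ 2))⁻¹ ≤ (t / x ^ 2)⁻¹ := by
          apply inv_anti₀ hpos
          linarith [Real.add_one_le_exp (t / x ^ 2)]
      _ = x ^ 2 / t := inv_div _ _

theorem measurable_w (t : ℝ) : Measurable (w t) := by
  unfold w
  exact Measurable.ite (measurableSet_singleton 0) measurable_const (by fun_prop)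

theorem hasDerivAt_w (ht : 0 < t) (x : ℝ) :
    HasDerivAt (w t) (-(2 * x - 2 * t / x ^ 3) * w t x) x := by
  by_cases hx : x = 0
  · subst hx
    have hO : (w t) =O[nhds 0] fun x : ℝ => ‖x - 0‖ ^ 2 := by
      refine Asymptotics.IsBigO.of_bound (1 / t) (Filter.Eventually.of_forall fun x => ?_)
      have h1 : Real.exp (-x ^ 2) ≤ 1 := by
        rw [Real.exp_le_one_iff]; nlinarith [sq_nonneg x]
      rw [Real.norm_of_nonneg (w_nonneg t x), norm_pow, norm_norm, sub_zero, Real.norm_eq_abs,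
        sq_abs]
      calc w t x ≤ x ^ 2 / t * Real.exp (-x ^ 2) := w_le ht x
        _ ≤ x ^ 2 / t * 1 := by gcongr
        _ = 1 / t * x ^ 2 := by ring
    have h0 := (hO.hasFDerivAt one_lt_two).hasDerivAt
    simpa [w] using h0
  · have hE : HasDerivAt (fun y : ℝ => Real.exp (-y ^ 2 - t / y ^ 2))
        (Real.exp (-x ^ 2 - t / x ^ 2) * (-(2 * x) - -(t * (2 * x)) / (x ^ 2) ^ 2)) x := by
      have h2 : HasDerivAt (fun y : ℝ => y ^ 2) (2 * x) x := by
        simpa using hasDerivAt_pow 2 x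
      refine HasDerivAt.exp (h2.neg.sub ?_)
      simpa [Pi.div_def] using (hasDerivAt_const x t).div h2 (pow_ne_zero 2 hx)
    have heq : w t =ᶠ[nhds x] fun y : ℝ => Real.exp (-y ^ 2 - t / y ^ 2) := by
      filter_upwards [isOpen_ne.mem_nhds hx] with y hy
      exact if_neg hy
    refine (hE.congr_of_eventuallyEq heq).congr_deriv ?_
    have hwx : w t x = Real.exp (-x ^ 2 - t / x ^ 2) := if_neg hx
    rw [hwx]
    field_simp
    ring

theorem integrable_polynomial_mul_gaussian (p : ℝ[X]) :
    Integrable fun x : ℝ => p.eval x * Real.exp (-x ^ 2) := by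
  induction p using Polynomial.induction_on' with
  | add p q hp hq => simpa [add_mul, Pi.add_def] using hp.add hq
  | monomial n a =>
    have h1 := (integrable_rpow_mul_exp_neg_mul_sq one_pos
      (s := n) (by linarith [n.cast_nonneg (α := ℝ)])).const_mul a
    simpa [mul_assoc] using h1

theorem integrable_polynomial_mul_w_div_sq (ht : 0 < t) (p : ℝ[X]) :
    Integrable fun x : ℝ => p.eval x * (w t x / x ^ 2) := by
  refine ((integrable_polynomial_mul_gaussian p).const_mul t⁻¹).mono
    (p.continuous.measurable.mul
      ((measurable_w t).div (measurable_id.pow_const 2))).aestronglyMeasurable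
    (Filter.Eventually.of_forall fun x => ?_)
  have hw : w t x / x ^ 2 ≤ t⁻¹ * Real.exp (-x ^ 2) := by
    by_cases hx : x = 0
    · subst hx; simp; positivity
    · rw [div_le_iff₀ (by positivity)]
      refine (w_le ht x).trans_eq ?_
      ring
  have hw0 : 0 ≤ w t x / x ^ 2 := div_nonneg (w_nonneg t x) (sq_nonneg x)
  have hg0 : 0 ≤ t⁻¹ * Real.exp (-x ^ 2) := by positivity
  rw [norm_mul, Real.norm_of_nonneg hw0, mul_left_comm, norm_mul, Real.norm_of_nonneg hg0]
  exact mul_le_mul_of_nonneg_left hw (norm_nonneg _)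

/-- Integration of polynomials against the weight `w t x / x ^ 2`. -/
noncomputable def integralWDivSq (ht : 0 < t) : ℝ[X] →ₗ[ℝ] ℝ where
  toFun p := ∫ x : ℝ, p.eval x * (w t x / x ^ 2)
  map_add' p q := by
    simp only [eval_add, add_mul]
    exact integral_add (integrable_polynomial_mul_w_div_sq ht p)
      (integrable_polynomial_mul_w_div_sq ht q)
  map_smul' c p := by
    simp only [eval_smul, smul_eq_mul, mul_assoc, RingHom.id_apply]
    exact integral_const_mul _ _

theorem integralWDivSq_apply (ht : 0 < t) (p : ℝ[X]) :
    integralWDivSq ht p = ∫ x : ℝ, p.eval x * (w t x / x ^ 2) := rfl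

theorem sq_mul_w_div_sq (t x : ℝ) : x ^ 2 * (w t x / x ^ 2) = w t x := by
  by_cases hx : x = 0
  · simp [hx, w]
  · field_simp

theorem integralWDivSq_X_sq_mul (ht : 0 < t) (p : ℝ[X]) :
    integralWDivSq ht (X ^ 2 * p) = ∫ x : ℝ, p.eval x * w t x := by
  rw [integralWDivSq_apply]
  congr 1 with x
  rw [eval_mul, eval_pow, eval_X, mul_comm (x ^ 2), mul_assoc, sq_mul_w_div_sq]

theorem integralWDivSq_comp_neg_X (ht : 0 < t) (p : ℝ[X]) :
    integralWDivSq ht (p.comp (-X)) = integralWDivSq ht p := by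
  rw [integralWDivSq_apply, integralWDivSq_apply,
    ← integral_neg_eq_self fun x : ℝ => p.eval x * (w t x / x ^ 2)]
  simp [w_neg]

theorem integralWDivSq_integration_by_parts (ht : 0 < t) (g : ℝ[X]) :
    integralWDivSq ht (X ^ 2 * derivative (X * g)) =
      2 * integralWDivSq ht (X ^ 2 * (X ^ 2 * g)) - 2 * t * integralWDivSq ht g := by
  have key : integralWDivSq ht (X ^ 2 * derivative (X * g)
      - ((2 : ℝ) • (X ^ 2 * (X ^ 2 * g)) - (2 * t) • g)) = 0 := by
    refine integral_eq_zero_of_hasDerivAt_of_integrable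
      (f := fun x => (X ^ 2 * (X * g)).eval x * (w t x / x ^ 2)) (fun x => ?_)
      (integrable_polynomial_mul_w_div_sq ht _) (integrable_polynomial_mul_w_div_sq ht _)
    have hd := ((X * g).hasDerivAt x).mul (hasDerivAt_w ht x)
    have hf : (fun x => (X ^ 2 * (X * g)).eval x * (w t x / x ^ 2))
        = fun x => (X * g).eval x * w t x := by
      ext y
      rw [eval_mul, eval_pow, eval_X, mul_comm (y ^ 2), mul_assoc, sq_mul_w_div_sq]
    rw [hf]
    refine hd.congr_deriv ?_
    by_cases hx : x = 0
    · simp [hx, w]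
    · rw [derivative_mul, derivative_X]
      simp only [eval_sub, eval_add, one_mul, eval_mul, eval_pow, eval_X, eval_smul, smul_eq_mul]
      field_simp
      ring
  rw [map_sub, map_sub, map_smul, map_smul, smul_eq_mul, smul_eq_mul] at key
  linarith

end Analysis

section Orthogonal

variable {M : ℝ[X] →ₗ[ℝ] ℝ} {P : ℕ → ℝ[X]}

theorem degree_sub_C_coeff_mul_lt (hmonic : ∀ n, (P n).Monic) (hdeg : ∀ n, (P n).natDegree = n)
    {n : ℕ} {Q : ℝ[X]}
    (hQ : Q.degree < ((n + 1 : ℕ) : WithBot ℕ)) :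
    (Q - C (Q.coeff n) * P n).degree < n := by
  have hlead : (P n).coeff n = 1 := by
    simpa [Monic, leadingCoeff, hdeg n] using hmonic n
  rw [degree_lt_iff_coeff_zero] at hQ ⊢
  intro m hm
  rw [coeff_sub, coeff_C_mul]
  rcases hm.eq_or_lt with rfl | hm
  · rw [hlead]; ring
  · rw [hQ m hm, coeff_eq_zero_of_natDegree_lt (p := P n) (by rw [hdeg]; exact hm)]; ring

theorem map_mul_eq_zero_of_degree_lt (hmonic : ∀ n, (P n).Monic) (hdeg : ∀ n, (P n).natDegree = n)
    (horth : ∀ m n, m ≠ n → M (P m * P n) = 0) {n : ℕ} {Q : ℝ[X]} (hQ : Q.degree < n) :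
    M (Q * P n) = 0 := by
  suffices H : ∀ k ≤ n, ∀ Q : ℝ[X], Q.degree < k → M (Q * P n) = 0 from H n le_rfl Q hQ
  intro k
  induction k with
  | zero =>
    intro _ Q hQ
    have : Q = 0 := by simpa using hQ
    simp [this]
  | succ k ih =>
    intro hk Q hQ
    have h1 := ih (by omega) _ (degree_sub_C_coeff_mul_lt hmonic hdeg hQ)
    rw [sub_mul, mul_assoc, ← smul_eq_C_mul, map_sub, map_smul, horth k n (by omega)] at h1
    simpa using h1

theorem map_mul_eq_coeff_mul (hmonic : ∀ n, (P n).Monic) (hdeg : ∀ n, (P n).natDegree = n)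
    (horth : ∀ m n, m ≠ n → M (P m * P n) = 0) {n : ℕ} {Q : ℝ[X]}
    (hQ : Q.degree < ((n + 1 : ℕ) : WithBot ℕ)) :
    M (Q * P n) = Q.coeff n * M (P n * P n) := by
  have h1 := map_mul_eq_zero_of_degree_lt hmonic hdeg horth
    (degree_sub_C_coeff_mul_lt hmonic hdeg hQ)
  rw [sub_mul, mul_assoc, ← smul_eq_C_mul, map_sub, map_smul, smul_eq_mul] at h1
  linarith

theorem eq_zero_of_map_mul_eq_zero (hmonic : ∀ n, (P n).Monic) (hdeg : ∀ n, (P n).natDegree = n)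
    (horth : ∀ m n, m ≠ n → M (P m * P n) = 0) (hpos : ∀ n, 0 < M (P n * P n))
    {n : ℕ} {Q : ℝ[X]} (hQ : Q.degree < n) (hQP : ∀ k < n, M (Q * P k) = 0) : Q = 0 := by
  induction n with
  | zero => simpa using hQ
  | succ n ih =>
    have h1 := map_mul_eq_coeff_mul hmonic hdeg horth hQ
    rw [hQP n n.lt_succ_self, eq_comm, mul_eq_zero] at h1
    refine ih ?_ fun k hk => hQP k (by omega)
    have h2 := degree_sub_C_coeff_mul_lt hmonic hdeg hQ
    simpa [h1.resolve_right (hpos n).ne'] using h2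

theorem comp_neg_X_eq (hmonic : ∀ n, (P n).Monic) (hdeg : ∀ n, (P n).natDegree = n)
    (horth : ∀ m n, m ≠ n → M (P m * P n) = 0) (hpos : ∀ n, 0 < M (P n * P n))
    (hsymm : ∀ p : ℝ[X], M (p.comp (-X)) = M p) (n : ℕ) :
    (P n).comp (-X) = C ((-1) ^ n) * P n := by
  have hcoeff (p : ℝ[X]) (m : ℕ) : (p.comp (-X)).coeff m = (-1) ^ m * p.coeff m := by
    have h1 : (-X : ℝ[X]) = C (-1) * X := by simp
    rw [h1, comp_C_mul_X_coeff, mul_comm]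
  have hlead : (P n).coeff n = 1 := by
    simpa [Monic, leadingCoeff, hdeg n] using hmonic n
  rw [← sub_eq_zero]
  refine eq_zero_of_map_mul_eq_zero hmonic hdeg horth hpos (n := n) ?_ fun k hk => ?_
  · rw [degree_lt_iff_coeff_zero]
    intro m hm
    rw [coeff_sub, coeff_C_mul, hcoeff]
    rcases hm.eq_or_lt with rfl | hm
    · ring
    · rw [coeff_eq_zero_of_natDegree_lt (p := P n) (by rw [hdeg]; exact hm)]; ring
  · have h1 : M ((P n).comp (-X) * P k) = M ((P k).comp (-X) * P n) := by
      rw [← hsymm]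
      simp [comp_assoc, mul_comm]
    have hk' : ((P k).comp (-X)).degree < n := by
      rw [degree_lt_iff_coeff_zero]
      intro m hm
      rw [hcoeff, coeff_eq_zero_of_natDegree_lt (p := P k) (by rw [hdeg]; omega), mul_zero]
    rw [sub_mul, mul_assoc, ← smul_eq_C_mul, map_sub, map_smul, horth n k hk.ne', h1,
      map_mul_eq_zero_of_degree_lt hmonic hdeg horth hk']
    simp

/-- The coefficient `β n` in the recurrence `X * P n = P (n + 1) + β n * P (n - 1)` of the monic
orthogonal polynomials of an even weight. -/
noncomputable def recurrenceCoeff (h : ℕ → ℝ) (n : ℕ) : ℝ := if n = 0 then 0 else h n / h (n - 1)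

theorem recurrenceCoeff_succ_mul {h : ℕ → ℝ} (hpos : ∀ n, 0 < h n) (n : ℕ) :
    recurrenceCoeff h (n + 1) * h n = h (n + 1) := by
  have := (hpos n).ne'
  simp [recurrenceCoeff, this]

theorem X_mul_eq (hmonic : ∀ n, (P n).Monic) (hdeg : ∀ n, (P n).natDegree = n)
    (horth : ∀ m n, m ≠ n → M (P m * P n) = 0) (hpos : ∀ n, 0 < M (P n * P n))
    (hsymm : ∀ p : ℝ[X], M (p.comp (-X)) = M p) (n : ℕ) :
    X * P n = P (n + 1) + C (recurrenceCoeff (fun n => M (P n * P n)) n) * P (n - 1) := by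
  set β := recurrenceCoeff (fun n => M (P n * P n))
  have hlead (k : ℕ) : (P k).coeff k = 1 := by
    simpa [Monic, leadingCoeff, hdeg k] using hmonic k
  have hvanish {m k : ℕ} (hmk : k < m) : (P k).coeff m = 0 :=
    coeff_eq_zero_of_natDegree_lt (by rw [hdeg]; exact hmk)
  have hXdeg (k : ℕ) : (X * P k).degree < ((k + 2 : ℕ) : WithBot ℕ) := by
    rw [degree_lt_iff_coeff_zero]
    rintro (_ | m) hm
    · omega
    · rw [coeff_X_mul]; exact hvanish (by omega)
  have hdiag : M (X * P n * P n) = 0 := by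
    have h1 := hsymm (X * P n * P n)
    have h2 : (X * P n * P n).comp (-X) = -(X * P n * P n) := by
      rw [mul_comp, mul_comp, X_comp, comp_neg_X_eq hmonic hdeg horth hpos hsymm]
      have : (C ((-1 : ℝ) ^ n)) * C ((-1) ^ n) = 1 := by
        rw [← C_mul, ← mul_pow]; simp
      linear_combination (-X * P n * P n) * this
    rw [h2, map_neg] at h1
    linarith
  rw [← sub_eq_zero]
  refine eq_zero_of_map_mul_eq_zero hmonic hdeg horth hpos (n := n + 1) ?_ fun k hk => ?_
  · rw [degree_lt_iff_coeff_zero]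
    rintro (_ | m) hm
    · omega
    · rw [coeff_sub, coeff_add, coeff_C_mul, coeff_X_mul,
        hvanish (m := m + 1) (k := n - 1) (by omega)]
      rcases (Nat.le_of_succ_le_succ hm).eq_or_lt with rfl | hm
      · rw [hlead, hlead]; ring
      · rw [hvanish (by omega), hvanish (by omega)]; ring
  · rw [sub_mul, add_mul, mul_assoc (C _), ← smul_eq_C_mul, map_sub, map_add, map_smul,
      horth (n + 1) k (by omega), smul_eq_mul]
    rcases (Nat.le_of_lt_succ hk).eq_or_lt with rfl | hkn
    · rw [hdiag]
      rcases k with _ | k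
      · simp [β, recurrenceCoeff]
      · rw [horth _ _ (by omega)]; ring
    · rw [mul_comm X, mul_assoc, mul_comm (P n)]
      rcases (Nat.succ_le_of_lt hkn).eq_or_lt with rfl | hkn'
      · rw [map_mul_eq_coeff_mul hmonic hdeg horth (hXdeg k), Nat.succ_eq_add_one, coeff_X_mul,
          hlead, Nat.add_sub_cancel,
          recurrenceCoeff_succ_mul (h := fun n => M (P n * P n)) hpos k]
        ring
      · rw [map_mul_eq_zero_of_degree_lt hmonic hdeg horth
          ((hXdeg k).trans_le (by exact_mod_cast hkn')), horth _ _ (by omega)]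
        ring

end Orthogonal

section CompatibilityRelations

variable {L : ℝ[X] →ₗ[ℝ] ℝ} {P : ℕ → ℝ[X]} {t : ℝ} {h R : ℕ → ℝ}

theorem recurrenceCoeff_mul_self {h : ℕ → ℝ} (hpos : ∀ n, 0 < h n) (n : ℕ) :
    recurrenceCoeff h n * h n = recurrenceCoeff h n ^ 2 * h (n - 1) := by
  rcases n with _ | n
  · simp [recurrenceCoeff]
  · rw [Nat.add_sub_cancel, ← recurrenceCoeff_succ_mul hpos n]; ring

/-- The first compatibility relation; `L` plays the role of integration against
`w t x / x ^ 2`. -/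
theorem two_mul_recurrenceCoeff_add (hmonic : ∀ n, (P n).Monic) (hdeg : ∀ n, (P n).natDegree = n)
    (horth : ∀ m n, m ≠ n → L (X ^ 2 * (P m * P n)) = 0)
    (hh : ∀ n, h n = L (X ^ 2 * (P n * P n))) (hpos : ∀ n, 0 < h n)
    (hrec : ∀ n, X * P n = P (n + 1) + C (recurrenceCoeff h n) * P (n - 1))
    (hparts : ∀ g : ℝ[X], L (X ^ 2 * derivative (X * g)) =
      2 * L (X ^ 2 * (X ^ 2 * g)) - 2 * t * L g)
    (hR : ∀ n, h n * R n = 2 * t * L (P n * P n)) (n : ℕ) :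
    2 * recurrenceCoeff h (n + 1) + 2 * recurrenceCoeff h n - 2 * n - 1 = R n := by
  have hlead : (P n).coeff n = 1 := by
    simpa [Monic, leadingCoeff, hdeg n] using hmonic n
  have hder : L (X ^ 2 * (X * derivative (P n) * P n)) = n * h n := by
    have hD : (X * derivative (P n)).degree < ((n + 1 : ℕ) : WithBot ℕ) := by
      rw [degree_lt_iff_coeff_zero]
      rintro (_ | m) hm
      · omega
      · rw [coeff_X_mul, coeff_derivative,
          coeff_eq_zero_of_natDegree_lt (by rw [hdeg]; omega), zero_mul]
    have h1 := map_mul_eq_coeff_mul (M := L ∘ₗ LinearMap.mulLeft ℝ (X ^ 2)) hmonic hdeg horth hD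
    have h2 : (X * derivative (P n)).coeff n = (n : ℝ) := by
      rcases n with _ | n
      · simp
      · rw [coeff_X_mul, coeff_derivative, hlead]; simp
    rw [h2] at h1
    rw [hh]
    exact h1
  have hsq : L (X ^ 2 * (X ^ 2 * (P n * P n)))
      = h (n + 1) + recurrenceCoeff h n ^ 2 * h (n - 1) := by
    have h1 : X ^ 2 * (X ^ 2 * (P n * P n)) = X ^ 2 * (P (n + 1) * P (n + 1))
        + (2 * recurrenceCoeff h n) • (X ^ 2 * (P (n + 1) * P (n - 1)))
        + (recurrenceCoeff h n ^ 2) • (X ^ 2 * (P (n - 1) * P (n - 1))) := by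
      have : X ^ 2 * (P n * P n) = (X * P n) * (X * P n) := by ring
      rw [this, hrec, smul_eq_C_mul, smul_eq_C_mul, C_mul, C_pow, C_ofNat]
      ring
    rw [h1, map_add, map_add, map_smul, map_smul, horth (n + 1) (n - 1) (by omega), hh, hh]
    simp
  have hp := hparts (P n * P n)
  have h3 : X ^ 2 * derivative (X * (P n * P n)) = X ^ 2 * (P n * P n)
      + (2 : ℝ) • (X ^ 2 * (X * derivative (P n) * P n)) := by
    rw [derivative_mul, derivative_mul, derivative_X, smul_eq_C_mul, C_ofNat]
    ring
  rw [h3, map_add, map_smul, hder, hsq, ← hh, ← hR, ← recurrenceCoeff_mul_self hpos,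
    ← recurrenceCoeff_succ_mul hpos n, smul_eq_mul] at hp
  apply mul_left_cancel₀ (hpos n).ne'
  linear_combination -hp

theorem map_X_mul_mul_succ (hmonic : ∀ n, (P n).Monic) (hdeg : ∀ n, (P n).natDegree = n)
    (horth : ∀ m n, m ≠ n → L (X ^ 2 * (P m * P n)) = 0)
    (hh : ∀ n, h n = L (X ^ 2 * (P n * P n)))
    (hparity : ∀ n, (P n).comp (-X) = C ((-1) ^ n) * P n) (n : ℕ) :
    L (X * (P (n + 1) * P n)) = (1 + (-1) ^ n) / 2 * h n := by
  have hlead (k : ℕ) : (P k).coeff k = 1 := by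
    simpa [Monic, leadingCoeff, hdeg k] using hmonic k
  have hdvd (k : ℕ) (hk : Odd k) : X ∣ P k := by
    rw [X_dvd_iff]
    have h1 := congrArg (eval 0) (hparity k)
    simp only [eval_comp, eval_neg, eval_X, neg_zero, eval_mul, eval_C, hk.neg_one_pow] at h1
    rw [coeff_zero_eq_eval_zero]
    linarith
  have hquot {k : ℕ} {Q : ℝ[X]} (hQ : P k = X * Q) : Q.degree < k := by
    rw [degree_lt_iff_coeff_zero]
    intro m hm
    rw [← coeff_X_mul, ← hQ]
    exact coeff_eq_zero_of_natDegree_lt (by rw [hdeg]; omega)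
  rcases n.even_or_odd with hn | hn
  · obtain ⟨Q, hQ⟩ := hdvd (n + 1) hn.add_one
    have h1 := map_mul_eq_coeff_mul (M := L ∘ₗ LinearMap.mulLeft ℝ (X ^ 2)) hmonic hdeg horth
      (hquot hQ)
    rw [← coeff_X_mul, ← hQ, hlead, one_mul] at h1
    rw [hn.neg_one_pow, hQ, hh]
    have h2 : X * (X * Q * P n) = X ^ 2 * (Q * P n) := by ring
    rw [h2]
    norm_num
    exact h1
  · obtain ⟨Q, hQ⟩ := hdvd n hn
    have h1 := map_mul_eq_zero_of_degree_lt (M := L ∘ₗ LinearMap.mulLeft ℝ (X ^ 2)) hmonic hdeg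
      horth ((hquot hQ).trans (by exact_mod_cast n.lt_succ_self))
    have h2 : X * (P (n + 1) * P n) = X ^ 2 * (Q * P (n + 1)) := by rw [hQ]; ring
    rw [hn.neg_one_pow, h2]
    norm_num
    exact h1

/-- The second compatibility relation. -/
theorem recurrenceCoeff_mul_sub (hmonic : ∀ n, (P n).Monic) (hdeg : ∀ n, (P n).natDegree = n)
    (horth : ∀ m n, m ≠ n → L (X ^ 2 * (P m * P n)) = 0)
    (hh : ∀ n, h n = L (X ^ 2 * (P n * P n))) (hpos : ∀ n, 0 < h n)
    (hrec : ∀ n, X * P n = P (n + 1) + C (recurrenceCoeff h n) * P (n - 1))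
    (hparity : ∀ n, (P n).comp (-X) = C ((-1) ^ n) * P n)
    (hR : ∀ n, h n * R n = 2 * t * L (P n * P n)) (n : ℕ) :
    recurrenceCoeff h (n + 1) * R (n + 1) - recurrenceCoeff h n * R (n - 1)
      = 2 * t * (-1) ^ n := by
  have hdiff : L (P (n + 1) * P (n + 1)) - recurrenceCoeff h n ^ 2 * L (P (n - 1) * P (n - 1))
      = L (X * (P (n + 1) * P n)) - recurrenceCoeff h n * L (X * (P n * P (n - 1))) := by
    rw [← smul_eq_mul (a := recurrenceCoeff h n ^ 2), ← smul_eq_mul (a := recurrenceCoeff h n),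
      ← map_smul, ← map_smul, ← map_sub, ← map_sub, smul_eq_C_mul, smul_eq_C_mul, C_pow]
    congr 1
    linear_combination (C (recurrenceCoeff h n) * P (n - 1) - P (n + 1)) * hrec n
  have hlow : recurrenceCoeff h n * L (X * (P n * P (n - 1))) = (1 - (-1) ^ n) / 2 * h n := by
    rcases n with _ | n
    · simp [recurrenceCoeff]
    · rw [Nat.add_sub_cancel, map_X_mul_mul_succ hmonic hdeg horth hh hparity,
        ← recurrenceCoeff_succ_mul hpos n, pow_succ]
      ring
  rw [map_X_mul_mul_succ hmonic hdeg horth hh hparity, hlow] at hdiff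
  have h1 := recurrenceCoeff_succ_mul hpos n
  have h2 := recurrenceCoeff_mul_self hpos n
  apply mul_left_cancel₀ (hpos n).ne'
  linear_combination R (n + 1) * h1 - R (n - 1) * h2 + hR (n + 1)
    - recurrenceCoeff h n ^ 2 * hR (n - 1) + 2 * t * hdiff

end CompatibilityRelations

/-- Elimination of `β` between the two first order relations. -/
theorem second_order_difference_equation {t : ℝ} {β R σ : ℕ → ℝ} (hβ0 : β 0 = 0)
    (hsum : ∀ n : ℕ, 2 * β (n + 1) + 2 * β n - 2 * n - 1 = R n)
    (hdiff : ∀ n : ℕ, β (n + 1) * R (n + 1) - β n * R (n - 1) = 2 * t * (-1) ^ n)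
    (hσ : ∀ n, σ n = -∑ j ∈ Finset.range n, R j) (n : ℕ) (hn : 1 ≤ n) :
    4 * (-1 : ℝ) ^ n * (n : ℝ) * t * (σ (n + 1) - σ (n - 1))
        * (4 * (-1 : ℝ) ^ n * t + (σ (n - 1) - σ n) * (σ n - σ (n + 1)))
      + (n : ℝ) ^ 2 * (σ (n - 1) - σ n) ^ 2 * (σ n - σ (n + 1)) ^ 2
      = (σ n - 2 * (1 - (-1 : ℝ) ^ n) * t)
        * (4 * (-1 : ℝ) ^ n * t + (σ (n - 1) - σ n) * (σ n - σ (n + 1))) ^ 2 := by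
  have hσs (n : ℕ) : σ (n + 1) = σ n - R n := by
    rw [hσ, hσ, Finset.sum_range_succ]; ring
  have hprod (n : ℕ) : β n * R n * R (n - 1) = -2 * t * (-1) ^ n * (2 * β n - n) := by
    induction n with
    | zero => simp [hβ0]
    | succ n ih =>
      rw [Nat.add_sub_cancel, pow_succ]
      push_cast
      linear_combination R n * hdiff n + ih - 2 * t * (-1) ^ n * hsum n
  have hquad (n : ℕ) : (2 * β n - n) ^ 2 + 2 * t * (1 - (-1) ^ n) - σ n
      = 2 * β n * (R n + R (n - 1)) := by
    induction n with
    | zero => simp [hβ0, hσ]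
    | succ n ih =>
      rw [Nat.add_sub_cancel, pow_succ, hσs]
      push_cast
      linear_combination ih - 2 * hdiff n + (2 * β (n + 1) - 2 * β n - 1) * hsum n
  obtain ⟨m, rfl⟩ : ∃ m, n = m + 1 := ⟨n - 1, by omega⟩
  have h1 := hprod (m + 1)
  have h2 := hquad (m + 1)
  rw [Nat.add_sub_cancel] at h1 h2 ⊢
  have e1 : σ m - σ (m + 1) = R m := by rw [hσs m]; ring
  have e2 : σ (m + 1) - σ (m + 1 + 1) = R (m + 1) := by rw [hσs (m + 1)]; ring
  have e3 : σ (m + 1 + 1) - σ m = -(R (m + 1) + R m) := by linarith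
  rw [e1, e2, e3]
  generalize σ (m + 1) = S at *
  generalize R (m + 1) = a at *
  generalize R m = b at *
  generalize β (m + 1) = β' at *
  generalize ((m + 1 : ℕ) : ℝ) = N at *
  generalize (-1 : ℝ) ^ (m + 1) = s at *
  set D := 4 * s * t + b * a with hD
  have hβD : β' * D = 2 * t * s * N := by rw [hD]; linear_combination h1
  have hrD : (2 * β' - N) * D = -N * (b * a) := by linear_combination 2 * hβD - N * hD
  linear_combination D ^ 2 * h2 - ((2 * β' - N) * D - N * (b * a)) * hrD
    + 2 * D * (a + b) * hβD

theorem statement10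
    (t : ℝ) (ht : 0 < t)
    (P : ℕ → Polynomial ℝ)
    (hmonic : ∀ n, (P n).Monic)
    (hdeg : ∀ n, (P n).natDegree = n)
    (horth : ∀ m n : ℕ, m ≠ n → ∫ x : ℝ, (P m).eval x * (P n).eval x * w t x = 0)
    (h : ℕ → ℝ)
    (hh : ∀ n, h n = ∫ x : ℝ, ((P n).eval x) ^ 2 * w t x)
    (hhpos : ∀ n, 0 < h n)
    (R : ℕ → ℝ)
    (hR : ∀ n, R n = 2 * t / h n * ∫ y : ℝ, ((P n).eval y) ^ 2 / y ^ 2 * w t y)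
    (σ : ℕ → ℝ)
    (hσ : ∀ n, σ n = -∑ j ∈ Finset.range n, R j)
    (n : ℕ) (hn : 1 ≤ n) :
    4 * (-1 : ℝ) ^ n * (n : ℝ) * t * (σ (n + 1) - σ (n - 1))
        * (4 * (-1 : ℝ) ^ n * t + (σ (n - 1) - σ n) * (σ n - σ (n + 1)))
      + (n : ℝ) ^ 2 * (σ (n - 1) - σ n) ^ 2 * (σ n - σ (n + 1)) ^ 2
      = (σ n - 2 * (1 - (-1 : ℝ) ^ n) * t)
        * (4 * (-1 : ℝ) ^ n * t + (σ (n - 1) - σ n) * (σ n - σ (n + 1))) ^ 2 := by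
  set L := integralWDivSq ht with hL
  have horth' : ∀ m n, m ≠ n → L (X ^ 2 * (P m * P n)) = 0 := fun m n hmn => by
    rw [hL, integralWDivSq_X_sq_mul, ← horth m n hmn]
    simp only [eval_mul]
  have hh' : ∀ n, h n = L (X ^ 2 * (P n * P n)) := fun n => by
    rw [hL, integralWDivSq_X_sq_mul, hh]
    simp only [eval_mul, sq]
  have hR' : ∀ n, h n * R n = 2 * t * L (P n * P n) := fun n => by
    have h1 : L (P n * P n) = ∫ y : ℝ, ((P n).eval y) ^ 2 / y ^ 2 * w t y := by
      rw [hL, integralWDivSq_apply]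
      congr 1 with y
      rw [eval_mul]
      ring
    have := (hhpos n).ne'
    rw [hR, h1]
    field_simp
  have hpos' : ∀ n, 0 < L (X ^ 2 * (P n * P n)) := fun n => hh' n ▸ hhpos n
  have hsymm : ∀ p : ℝ[X], (L ∘ₗ LinearMap.mulLeft ℝ (X ^ 2)) (p.comp (-X))
      = (L ∘ₗ LinearMap.mulLeft ℝ (X ^ 2)) p := fun p => by
    have h1 := integralWDivSq_comp_neg_X ht (X ^ 2 * p)
    simpa using h1
  have hparity := comp_neg_X_eq (M := L ∘ₗ LinearMap.mulLeft ℝ (X ^ 2)) hmonic hdeg horth' hpos'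
    hsymm
  have hrec : ∀ n, X * P n = P (n + 1) + C (recurrenceCoeff h n) * P (n - 1) := by
    rw [funext hh']
    exact X_mul_eq (M := L ∘ₗ LinearMap.mulLeft ℝ (X ^ 2)) hmonic hdeg horth' hpos' hsymm
  exact second_order_difference_equation (β := recurrenceCoeff h) (if_pos rfl)
    (two_mul_recurrenceCoeff_add hmonic hdeg horth' hh' hhpos hrec
      (integralWDivSq_integration_by_parts ht) hR')
    (recurrenceCoeff_mul_sub hmonic hdeg horth' hh' hhpos hrec hparity hR') hσ n hn
end

section
/- Fix n ∈ ℕ and set ε = (−1)^n. Suppose r, R : (0,∞) → ℝ are such that R is twice differentiable, r is differentiable, R(t) > 0 for all t > 0, and for all t > 0: r'(t) = −2ε r(t)/R(t) − (n + r(t)) R(t)/(2t) and 2t R'(t) = R(t)² + (1 − 2 r(t)) R(t) − 4ε t. Then R satisfies the Painlevé III' equation R''(t) = (R'(t))²/R(t) − R'(t)/t + (2n+1) R(t)²/(4t²) − ε/t + R(t)³/(4t²) − 4/R(t) for all t > 0. -/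
theorem statement16
    (n : ℕ) (ε : ℝ) (hε : ε = (-1 : ℝ) ^ n)
    (r R : ℝ → ℝ)
    (hRdiff : ∀ t : ℝ, 0 < t → DifferentiableAt ℝ R t)
    (hRdiff2 : ∀ t : ℝ, 0 < t → DifferentiableAt ℝ (deriv R) t)
    (hrdiff : ∀ t : ℝ, 0 < t → DifferentiableAt ℝ r t)
    (hRpos : ∀ t : ℝ, 0 < t → 0 < R t)
    (hode1 : ∀ t : ℝ, 0 < t →
      deriv r t = -2 * ε * r t / R t - ((n : ℝ) + r t) * R t / (2 * t))
    (hode2 : ∀ t : ℝ, 0 < t →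
      2 * t * deriv R t = (R t) ^ 2 + (1 - 2 * r t) * R t - 4 * ε * t) :
    ∀ t : ℝ, 0 < t →
      deriv (deriv R) t = (deriv R t) ^ 2 / R t - deriv R t / t
        + (2 * (n : ℝ) + 1) * (R t) ^ 2 / (4 * t ^ 2) - ε / t
        + (R t) ^ 3 / (4 * t ^ 2) - 4 / R t := by
  intro t ht
  have hε2 : ε ^ 2 = 1 := by rw [hε, ← pow_mul, mul_comm, pow_mul]; norm_num
  have hR0 := (hRpos t ht).ne'
  have hR := (hRdiff t ht).hasDerivAt
  have hr := (hrdiff t ht).hasDerivAt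
  have hlhs : HasDerivAt (fun s => 2 * s * deriv R s) (2 * deriv R t + 2 * t * deriv (deriv R) t) t := by
    have h := ((hasDerivAt_id' t).const_mul 2).fun_mul (hRdiff2 t ht).hasDerivAt
    rwa [mul_one] at h
  have hrhs := ((hR.fun_pow 2).fun_add (((hr.const_mul 2).const_sub 1).fun_mul hR)).fun_sub
    ((hasDerivAt_id' t).const_mul (4 * ε))
  have heq : (fun s => 2 * s * deriv R s) =ᶠ[nhds t]
      fun s => R s ^ 2 + (1 - 2 * r s) * R s - 4 * ε * s := by
    filter_upwards [lt_mem_nhds ht] with s hs using hode2 s hs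
  have hderiv := hlhs.unique (hrhs.congr_of_eventuallyEq heq)
  rw [hode1 t ht] at hderiv
  have h2 := hode2 t ht
  generalize deriv (deriv R) t = R'' at *
  generalize deriv R t = R' at *
  generalize R t = x at *
  have hrt : r t = (x ^ 2 + x - 4 * ε * t - 2 * t * R') / (2 * x) := by
    field_simp
    linarith
  rw [hrt] at hderiv
  have ht0 := ht.ne'
  have hsolve : R'' = (2 * t * R'') / (2 * t) := by field_simp
  rw [hsolve, eq_sub_of_add_eq' hderiv]
  field_simp
  ring_nf
  simp only [hε2]
  ring
end
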